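/- Let f : E → ℝ be convex and differentiable with ∇f L-Lipschitz, and let x* be a minimizer of f. Let θ ∈ (0, 1], x, v ∈ E, and set y := (1 - θ) x + θ v, x⁺ := y - (1/L) ∇f(y), v⁺ := v - (1/(L θ)) ∇f(y). Then the one-step Lyapunov estimate holds: (1/(L θ²)) ( f(x⁺) - f(x*) ) + (1/2) ‖x* - v⁺‖² ≤ ((1 - θ)/(L θ²)) ( f(x) - f(x*) ) + (1/2) ‖x* - v‖². -/

import Mathlib

open scoped RealInnerProductSpace

theorem aux_line {E : Type*} [NormedAddCommGroup E] [InnerProductSpace ℝ E]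
    [FiniteDimensional ℝ E] (f : E → ℝ) (hdiff : Differentiable ℝ f) (y d : E) (t : ℝ) :
    HasDerivAt (fun s : ℝ => f (y + s • d)) ⟪gradient f (y + t • d), d⟫ t := by
  have h1 : HasDerivAt (fun s : ℝ => y + s • d) d t := by
    simpa using ((hasDerivAt_id t).smul_const d).const_add y
  have h2 := (hdiff (y + t • d)).hasGradientAt.hasFDerivAt
  have h3 := h2.comp_hasDerivAt t h1
  exact h3

theorem aux_descent {E : Type*} [NormedAddCommGroup E] [InnerProductSpace ℝ E]
    [FiniteDimensional ℝ E] (f : E → ℝ) (hdiff : Differentiable ℝ f)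
    (L : ℝ) (hL : 0 < L) (hlip : LipschitzWith (Real.toNNReal L) (gradient f)) (y d : E) :
    f (y + d) ≤ f y + ⟪gradient f y, d⟫ + L / 2 * ‖d‖ ^ 2 := by
  have hd : ∀ t : ℝ, HasDerivAt
      (fun s : ℝ => f (y + s • d) - (s * ⟪gradient f y, d⟫ + L / 2 * ‖d‖ ^ 2 * s ^ 2))
      (⟪gradient f (y + t • d), d⟫ - (⟪gradient f y, d⟫ + L * ‖d‖ ^ 2 * t)) t := by
    intro t
    have h := (aux_line f hdiff y d t).sub
      (((hasDerivAt_id t).mul_const ⟪gradient f y, d⟫).add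
        ((hasDerivAt_pow 2 t).const_mul (L / 2 * ‖d‖ ^ 2)))
    refine h.congr_deriv ?_
    norm_num
    ring
  have hanti := antitoneOn_of_deriv_nonpos (convex_Icc (0 : ℝ) 1)
    (fun t _ => (hd t).continuousAt.continuousWithinAt)
    (fun t _ => (hd t).differentiableAt.differentiableWithinAt)
    (by
      intro t ht
      rw [interior_Icc] at ht
      rw [(hd t).deriv]
      have h1 := real_inner_le_norm (gradient f (y + t • d) - gradient f y) d
      have h2 := hlip.dist_le_mul (y + t • d) y
      rw [dist_eq_norm, dist_eq_norm, Real.coe_toNNReal L hL.le, add_sub_cancel_left,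
        norm_smul, Real.norm_eq_abs, abs_of_pos ht.1] at h2
      rw [inner_sub_left] at h1
      have h3 := mul_le_mul_of_nonneg_right h2 (norm_nonneg d)
      nlinarith)
  have h := hanti (Set.left_mem_Icc.2 zero_le_one) (Set.right_mem_Icc.2 zero_le_one) zero_le_one
  simp only [one_smul, zero_smul, add_zero] at h
  linarith

theorem aux_convex {E : Type*} [NormedAddCommGroup E] [InnerProductSpace ℝ E]
    [FiniteDimensional ℝ E] (f : E → ℝ) (hconv : ConvexOn ℝ Set.univ f)
    (hdiff : Differentiable ℝ f) (y z : E) :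
    f y + ⟪gradient f y, z - y⟫ ≤ f z := by
  have hc : ConvexOn ℝ Set.univ (fun s : ℝ => f (y + s • (z - y))) := by
    refine ⟨convex_univ, ?_⟩
    intro a _ b _ p q hp hq hpq
    have h := hconv.2 (Set.mem_univ (y + a • (z - y))) (Set.mem_univ (y + b • (z - y))) hp hq hpq
    have e : y + (p • a + q • b) • (z - y) = p • (y + a • (z - y)) + q • (y + b • (z - y)) := by
      have : q = 1 - p := by linarith
      subst this
      simp only [smul_eq_mul]
      module
    simpa only [e] using h
  have h := hc.le_slope_of_hasDerivAt (Set.mem_univ 0) (Set.mem_univ 1) zero_lt_one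
    (aux_line f hdiff y (z - y) 0)
  simp only [slope_def_field, zero_smul, one_smul, add_zero, sub_zero, div_one,
    add_sub_cancel] at h
  linarith

/-- One-step Lyapunov estimate for Nesterov's method in the smooth
convex case: with `y = (1-θ)x + θv`, `x⁺ = y - (1/L)∇f(y)`,
`v⁺ = v - (1/(Lθ))∇f(y)`, one has
`(1/(Lθ²))(f(x⁺) - f(x*)) + (1/2)‖x* - v⁺‖²
  ≤ ((1-θ)/(Lθ²))(f(x) - f(x*)) + (1/2)‖x* - v‖²`. -/
theorem one_step_lyapunov_estimate
    {E : Type*} [NormedAddCommGroup E] [InnerProductSpace ℝ E] [FiniteDimensional ℝ E]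
    (f : E → ℝ) (hconv : ConvexOn ℝ Set.univ f) (hdiff : Differentiable ℝ f)
    (L : ℝ) (hL : 0 < L)
    (hlip : LipschitzWith (Real.toNNReal L) (gradient f))
    (xstar : E) (hmin : ∀ z : E, f xstar ≤ f z)
    (θ : ℝ) (hθ : θ ∈ Set.Ioc (0 : ℝ) 1)
    (x v : E) :
    (1 / (L * θ ^ 2))
        * (f (((1 - θ) • x + θ • v)
              - (1 / L) • gradient f ((1 - θ) • x + θ • v)) - f xstar)
      + (1 / 2) * ‖xstar - (v - (1 / (L * θ)) • gradient f ((1 - θ) • x + θ • v))‖ ^ 2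
    ≤ ((1 - θ) / (L * θ ^ 2)) * (f x - f xstar)
      + (1 / 2) * ‖xstar - v‖ ^ 2 := by
  obtain ⟨h0, h1⟩ := hθ
  set y := (1 - θ) • x + θ • v with hy
  set G := gradient f y with hG
  have A := aux_descent f hdiff L hL hlip y (-((1 / L) • G))
  rw [← sub_eq_add_neg, ← hG, inner_neg_right, real_inner_smul_right, norm_neg, norm_smul,
    real_inner_self_eq_norm_sq, Real.norm_eq_abs, abs_of_pos (by positivity)] at A
  have B := aux_convex f hconv hdiff y x
  have C := aux_convex f hconv hdiff y xstar
  rw [← hG] at B C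
  have D : (1 - θ) * ⟪G, x - y⟫ + θ * ⟪G, xstar - y⟫ = θ * ⟪G, xstar - v⟫ := by
    rw [← real_inner_smul_right, ← real_inner_smul_right, ← real_inner_smul_right,
      ← inner_add_right]
    congr 1
    rw [hy]
    module
  have N : ‖xstar - (v - (1 / (L * θ)) • G)‖ ^ 2 = ‖xstar - v‖ ^ 2
      + 2 * (1 / (L * θ)) * ⟪G, xstar - v⟫ + (1 / (L * θ)) ^ 2 * ‖G‖ ^ 2 := by
    rw [← sub_add, norm_add_sq_real, real_inner_smul_right, norm_smul, Real.norm_eq_abs,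
      mul_pow, sq_abs, real_inner_comm]
    ring
  rw [N]
  have A' : f (y - (1 / L) • G) ≤ f y - ‖G‖ ^ 2 / (2 * L) := by
    refine A.trans (le_of_eq ?_)
    field_simp
    ring
  have B' := mul_le_mul_of_nonneg_left B (sub_nonneg.2 h1)
  have C' := mul_le_mul_of_nonneg_left C h0.le
  have K : f (y - (1 / L) • G) - f xstar + θ * ⟪G, xstar - v⟫ + ‖G‖ ^ 2 / (2 * L)
      ≤ (1 - θ) * (f x - f xstar) := by
    nlinarith
  have K' := mul_le_mul_of_nonneg_left K (show 0 ≤ 1 / (L * θ ^ 2) by positivity)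
  have e1 : 1 / (L * θ ^ 2) * (f (y - (1 / L) • G) - f xstar + θ * ⟪G, xstar - v⟫
      + ‖G‖ ^ 2 / (2 * L)) = 1 / (L * θ ^ 2) * (f (y - (1 / L) • G) - f xstar)
      + (1 / (L * θ)) * ⟪G, xstar - v⟫ + 1 / 2 * ((1 / (L * θ)) ^ 2 * ‖G‖ ^ 2) := by
    field_simp
  have e2 : 1 / (L * θ ^ 2) * ((1 - θ) * (f x - f xstar))
      = (1 - θ) / (L * θ ^ 2) * (f x - f xstar) := by ring
  linarith
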